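/- Let Γ be a group acting by homeomorphisms on a compact metrizable space Z, and suppose the action is a convergence action (properly discontinuous on the space of distinct triples) whose limit set Λ has cardinality at least 3. Then Λ is perfect and the action of Γ on Λ is minimal (every Γ-orbit in Λ is dense in Λ). -/

import Mathlib

open Filter Topology Set

/-- A total and cototal relation without three disjoint edges, on a set with at least three
points, is covered by one row and one column (a case of König's theorem). -/
theorem exists_row_column_cover {Z : Type*} {R : Z → Z → Prop}
    (hl : ∀ p, ∃ q, R p q) (hr : ∀ q, ∃ p, R p q)
    (h3 : ∀ p₁ p₂ p₃ q₁ q₂ q₃, R p₁ q₁ → R p₂ q₂ → R p₃ q₃ →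
      p₁ ≠ p₂ → p₁ ≠ p₃ → p₂ ≠ p₃ → q₁ ≠ q₂ → q₁ ≠ q₃ → q₂ ≠ q₃ → False)
    (hZ : ∀ a b : Z, ∃ c, c ≠ a ∧ c ≠ b) (o : Z) :
    ∃ w z, ∀ p q, R p q → p = w ∨ q = z := by
  have aux : ∀ x y a b c, R x a → R y b → R x c → x ≠ y → a ≠ b → c ≠ a → c ≠ b →
      ∀ p q, R p q → p = x ∨ q = b := by
    intro x y a b c hxa hyb hxc hxy hab hca hcb p q hpq
    by_contra! h
    obtain ⟨hpx, hqb⟩ := h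
    obtain ⟨d, hdx, hdy⟩ := hZ x y
    obtain ⟨e, hde⟩ := hl d
    have heb : e = b := by
      by_contra heb
      by_cases hea : e = a
      · exact h3 d x y e c b hde hxc hyb hdx hdy hxy (by grind) heb hcb
      · exact h3 d x y e a b hde hxa hyb hdx hdy hxy hea heb hab
    subst heb
    obtain ⟨a', ha', hqa', hab'⟩ : ∃ a', R x a' ∧ q ≠ a' ∧ a' ≠ e := by grind
    obtain ⟨y', hy', hpy', hxy'⟩ : ∃ y', R y' e ∧ p ≠ y' ∧ x ≠ y' := by grind
    exact h3 p x y' q a' e hpq ha' hy' hpx hpy' hxy' hqa' hqb hab'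
  by_contra! hcon
  obtain ⟨a, hoa⟩ := hl o
  obtain ⟨y, b, hyb, hyo, hba⟩ := hcon o a
  obtain ⟨c, hca, hcb⟩ := hZ a b
  obtain ⟨p, hpc⟩ := hr c
  have hp : p = o ∨ p = y := by
    by_contra! h
    exact h3 p o y c a b hpc hoa hyb h.1 h.2 hyo.symm hca hcb hba.symm
  rcases hp with rfl | rfl
  · obtain ⟨p', q', h, h1, h2⟩ := hcon p b
    rcases aux p y a b c hoa hyb hpc hyo.symm hba.symm hca hcb p' q' h with h | h
    exacts [h1 h, h2 h]
  · obtain ⟨p', q', h, h1, h2⟩ := hcon p a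
    rcases aux p o b a c hyb hoa hpc hyo hba hcb hca p' q' h with h | h
    exacts [h1 h, h2 h]

theorem Ultrafilter.exists_tendsto {ι Z : Type*} [TopologicalSpace Z] [CompactSpace Z]
    (F : Ultrafilter ι) (f : ι → Z) :
    ∃ z, Tendsto f F (𝓝 z) := by
  obtain ⟨z, -, hz⟩ := isCompact_univ.ultrafilter_le_nhds (F.map f) (by simp)
  exact ⟨z, hz⟩

/-- The action on the space of distinct triples is properly discontinuous. -/
def IsConvergenceAction (Γ Z : Type*) [Group Γ] [TopologicalSpace Z] [MulAction Γ Z] : Prop :=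
  ∀ K : Set (Z × Z × Z), IsCompact K →
    (∀ t ∈ K, t.1 ≠ t.2.1 ∧ t.1 ≠ t.2.2 ∧ t.2.1 ≠ t.2.2) → {g : Γ | ∃ t ∈ K, g • t ∈ K}.Finite

/-- `w` and `z` are the repelling and attracting points of infinitely many elements of `Γ`. -/
def IsLimitPair (Γ : Type*) {Z : Type*} [Group Γ] [TopologicalSpace Z] [MulAction Γ Z]
    (w z : Z) : Prop :=
  ∀ U ∈ 𝓝 w, ∀ V ∈ 𝓝 z, {g : Γ | MapsTo (g • ·) Uᶜ V}.Infinite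

section ConvergenceAction

variable {Γ Z ι : Type*} [Group Γ] [TopologicalSpace Z] [MulAction Γ Z]

/-- Along `l`, the elements `k i` converge to `z` locally uniformly away from `w`. -/
def ConvergesOff (k : ι → Γ) (l : Filter ι) (w z : Z) : Prop :=
  ∀ U ∈ 𝓝 w, ∀ V ∈ 𝓝 z, ∀ᶠ i in l, MapsTo (k i • ·) Uᶜ V

theorem ConvergesOff.tendsto [T1Space Z] {k : ι → Γ} {l : Filter ι} {w z x : Z}
    (h : ConvergesOff k l w z) (hx : x ≠ w) : Tendsto (fun i => k i • x) l (𝓝 z) := by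
  refine tendsto_def.2 fun V hV => ?_
  filter_upwards [h {x}ᶜ (isOpen_compl_singleton.mem_nhds hx.symm) V hV] with i hi
  exact hi (by simp)

variable [T2Space Z] [CompactSpace Z]

theorem IsConvergenceAction.eventually_eq (hΓ : IsConvergenceAction Γ Z) (F : Ultrafilter ι)
    {k : ι → Γ} {t : ι → Z × Z × Z} {a b : Z × Z × Z}
    (ha : a.1 ≠ a.2.1 ∧ a.1 ≠ a.2.2 ∧ a.2.1 ≠ a.2.2)
    (hb : b.1 ≠ b.2.1 ∧ b.1 ≠ b.2.2 ∧ b.2.1 ≠ b.2.2)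
    (hta : Tendsto t F (𝓝 a)) (htb : Tendsto (fun i => k i • t i) F (𝓝 b)) :
    ∃ k₀, ∀ᶠ i in F, k i = k₀ := by
  have hopen : IsOpen {t : Z × Z × Z | t.1 ≠ t.2.1 ∧ t.1 ≠ t.2.2 ∧ t.2.1 ≠ t.2.2} :=
    (isOpen_ne_fun (by fun_prop) (by fun_prop)).inter
      ((isOpen_ne_fun (by fun_prop) (by fun_prop)).inter
        (isOpen_ne_fun (by fun_prop) (by fun_prop)))
  obtain ⟨K₁, hK₁, hK₁s, hK₁c⟩ := local_compact_nhds (hopen.mem_nhds ha)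
  obtain ⟨K₂, hK₂, hK₂s, hK₂c⟩ := local_compact_nhds (hopen.mem_nhds hb)
  have hfin := hΓ (K₁ ∪ K₂) (hK₁c.union hK₂c) (fun t ht => ht.elim (@hK₁s t) (@hK₂s t))
  have hev : ∀ᶠ i in F, ∃ g ∈ {g : Γ | ∃ t ∈ K₁ ∪ K₂, g • t ∈ K₁ ∪ K₂}, k i = g := by
    filter_upwards [hta hK₁, htb hK₂] with i h₁ h₂
    exact ⟨k i, ⟨t i, Or.inl h₁, Or.inr h₂⟩, rfl⟩
  have hmem : (⋃ g ∈ {g : Γ | ∃ t ∈ K₁ ∪ K₂, g • t ∈ K₁ ∪ K₂}, {i | k i = g}) ∈ F := by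
    filter_upwards [hev] with i hi
    simpa using hi
  obtain ⟨g, -, hg⟩ := (Ultrafilter.finite_biUnion_mem_iff hfin).1 hmem
  exact ⟨g, hg⟩

theorem IsConvergenceAction.exists_convergesOff (hΓ : IsConvergenceAction Γ Z)
    (hZ : ∀ a b : Z, ∃ c, c ≠ a ∧ c ≠ b) (o : Z) (F : Ultrafilter ι) {k : ι → Γ}
    (hk : Tendsto k F cofinite) : ∃ w z : Z, ConvergesOff k F w z := by
  obtain ⟨w, z, hwz⟩ := exists_row_column_cover
    (R := fun p q : Z => ∃ f : ι → Z, Tendsto f F (𝓝 p) ∧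
      Tendsto (fun i => k i • f i) F (𝓝 q))
    (fun p => (Ultrafilter.exists_tendsto F fun i => k i • p).imp
      fun q hq => ⟨fun _ => p, tendsto_const_nhds, hq⟩)
    (fun q => (Ultrafilter.exists_tendsto F fun i => (k i)⁻¹ • q).imp
      fun p hp => ⟨_, hp, by simp⟩)
    (by
      rintro p₁ p₂ p₃ q₁ q₂ q₃ ⟨f₁, hp₁, hq₁⟩ ⟨f₂, hp₂, hq₂⟩ ⟨f₃, hp₃, hq₃⟩ h₁ h₂ h₃ h₄ h₅ h₆
      obtain ⟨k₀, hk₀⟩ := hΓ.eventually_eq F (k := k) (t := fun i => (f₁ i, f₂ i, f₃ i))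
        (a := (p₁, p₂, p₃)) (b := (q₁, q₂, q₃)) ⟨h₁, h₂, h₃⟩ ⟨h₄, h₅, h₆⟩
        (hp₁.prodMk_nhds (hp₂.prodMk_nhds hp₃)) (hq₁.prodMk_nhds (hq₂.prodMk_nhds hq₃))
      have hne := hk (Set.finite_singleton k₀).compl_mem_cofinite
      obtain ⟨i, hi, hi'⟩ := (hk₀.and hne).exists
      exact hi' hi)
    hZ o
  refine ⟨w, z, fun U hU V hV => ?_⟩
  by_contra hcon
  rw [Ultrafilter.eventually_not.symm] at hcon
  have hch : ∀ i, ∃ x, ¬ MapsTo (k i • ·) Uᶜ V → x ∈ Uᶜ ∧ k i • x ∉ V := by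
    intro i
    by_cases h : MapsTo (k i • ·) Uᶜ V
    · exact ⟨o, fun h' => absurd h h'⟩
    · simp only [MapsTo, not_forall] at h
      obtain ⟨x, hx, hx'⟩ := h
      exact ⟨x, fun _ => ⟨hx, hx'⟩⟩
  choose f hf using hch
  obtain ⟨p, hp⟩ := Ultrafilter.exists_tendsto F f
  obtain ⟨q, hq⟩ := Ultrafilter.exists_tendsto F fun i => k i • f i
  rcases hwz p q ⟨f, hp, hq⟩ with rfl | rfl
  · obtain ⟨i, hi, hi'⟩ := (hcon.and (hp hU)).exists
    exact (hf i hi).1 hi'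
  · obtain ⟨i, hi, hi'⟩ := (hcon.and (hq hV)).exists
    exact (hf i hi).2 hi'

variable [ContinuousConstSMul Γ Z]

/-- A global fixed point that repels infinitely many elements is the repelling fixed point of a
loxodromic element. -/
theorem IsConvergenceAction.exists_loxodromic (hΓ : IsConvergenceAction Γ Z)
    (hZ : ∀ a b : Z, ∃ c, c ≠ a ∧ c ≠ b) {z a b : Z} (hz : ∀ g : Γ, g • z = z)
    (haz : a ≠ z) (hbz : b ≠ z) (hab : a ≠ b) (ha : IsLimitPair Γ z a) :
    ∃ (g : Γ) (c : Z), c ≠ z ∧ g • c = c ∧ ConvergesOff (g ^ · : ℕ → Γ) atTop z c := by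
  have hne : ∀ (g : Γ) (x : Z), x ≠ z → g • x ≠ z := fun g x hx h =>
    hx (smul_left_cancel g (h.trans (hz g).symm))
  obtain ⟨V, hV, hVc, hVs⟩ := exists_mem_nhds_isClosed_subset
    (((Set.finite_singleton b).insert z).isClosed.isOpen_compl.mem_nhds
      (show a ∈ ({z, b} : Set Z)ᶜ by simp [haz, hab]))
  have hzV : z ∉ V := fun h => hVs h (by simp)
  have hbV : b ∉ V := fun h => hVs h (by simp)
  have hU : (V ∪ {b})ᶜ ∈ 𝓝 z := (hVc.union isClosed_singleton).isOpen_compl.mem_nhds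
    (by simp [hzV, hbz.symm])
  obtain ⟨g, hg⟩ := (ha _ hU V hV).nonempty
  rw [compl_compl] at hg
  have hpow : ∀ n : ℕ, ∀ x ∈ V ∪ {b}, g ^ (n + 1) • x ∈ V := by
    intro n
    induction n with
    | zero => intro x hx; simpa using hg hx
    | succ n ih =>
      intro x hx
      rw [pow_succ', mul_smul]
      exact hg (Or.inl (ih x hx))
  have hinj : Function.Injective (fun n : ℕ => g ^ n) := by
    refine injective_pow_iff_not_isOfFinOrder.2 fun hfin => ?_
    obtain ⟨n, hn, h1⟩ := isOfFinOrder_iff_pow_eq_one.1 hfin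
    obtain ⟨m, rfl⟩ := Nat.exists_eq_succ_of_ne_zero hn.ne'
    have := hpow m b (by simp)
    rw [Nat.succ_eq_add_one] at h1
    rw [h1, one_smul] at this
    exact hbV this
  have key : ∀ F : Ultrafilter ℕ, (F : Filter ℕ) ≤ atTop →
      ∃ c : Z, c ≠ z ∧ g • c = c ∧ ConvergesOff (g ^ · : ℕ → Γ) F z c := by
    intro F hF
    obtain ⟨w, c, hc⟩ := hΓ.exists_convergesOff hZ z F (k := (g ^ · : ℕ → Γ))
      (hinj.tendsto_cofinite.mono_left (Nat.cofinite_eq_atTop ▸ hF))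
    obtain ⟨x, hx, hxw⟩ : ∃ x ∈ V ∪ {b}, x ≠ w := by
      by_cases h : b = w
      · exact ⟨a, Or.inl (mem_of_mem_nhds hV), h ▸ hab⟩
      · exact ⟨b, by simp, h⟩
    have hxc := hc.tendsto hxw
    have hcV : c ∈ V := by
      refine hVc.mem_of_tendsto hxc ?_
      filter_upwards [hF (eventually_ge_atTop 1)] with n hn
      obtain ⟨m, rfl⟩ := Nat.exists_eq_add_of_le' hn
      exact hpow m x hx
    have hcz : c ≠ z := fun h => hzV (h ▸ hcV)
    obtain rfl : z = w := by
      by_contra hzw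
      have := hc.tendsto hzw
      simp only [hz] at this
      exact hcz (tendsto_nhds_unique this tendsto_const_nhds)
    refine ⟨c, hcz, ?_, hc⟩
    have h1 := hc.tendsto (hne g x hxw)
    have h2 := hxc.const_smul g
    refine tendsto_nhds_unique h2 (h1.congr fun n => ?_)
    rw [← mul_smul, ← mul_smul, (Commute.pow_self g n).eq]
  obtain ⟨c, hcz, hgc, hc⟩ := key (Ultrafilter.of atTop) (Ultrafilter.of_le _)
  refine ⟨g, c, hcz, hgc, fun U hU V hV => ?_⟩
  refine mem_iff_ultrafilter.2 fun F hF => ?_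
  obtain ⟨c', -, -, hc'⟩ := key F hF
  have hpc : ∀ n : ℕ, g ^ n • c = c := fun n => by
    induction n with
    | zero => simp
    | succ n ih => rw [pow_succ, mul_smul, hgc, ih]
  have := hc'.tendsto hcz
  simp only [hpc] at this
  obtain rfl := tendsto_nhds_unique this tendsto_const_nhds
  exact hc' U hU V hV

/-- A loxodromic element whose repelling fixed point `z` is a global fixed point has a globally
fixed attracting point, as soon as there is a third point. -/
theorem IsConvergenceAction.smul_eq_of_loxodromic (hΓ : IsConvergenceAction Γ Z)
    {z c x : Z} (hz : ∀ g : Γ, g • z = z) (hcz : c ≠ z) (hxz : x ≠ z) (hxc : x ≠ c) {g : Γ}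
    (hgc : g • c = c) (hg : ConvergesOff (g ^ · : ℕ → Γ) atTop z c) (h : Γ) : h • c = c := by
  have hne : ∀ (g : Γ) (x : Z), x ≠ z → g • x ≠ z := fun g x hx h =>
    hx (smul_left_cancel g (h.trans (hz g).symm))
  obtain ⟨C, hC, hCc, hCs⟩ := exists_mem_nhds_isClosed_subset
    (isOpen_compl_singleton.mem_nhds (show z ∈ ({c} : Set Z)ᶜ from hcz.symm))
  have hcC : c ∉ C := fun h => hCs h rfl
  have hexit : ∀ y : Z, y ≠ z → ∃ m : ℕ, g ^ m • y ∉ C := fun y hy =>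
    ((hg.tendsto hy).eventually (hCc.isOpen_compl.mem_nhds hcC)).exists
  have hback : Tendsto (fun n : ℕ => (g ^ n)⁻¹ • x) atTop (𝓝 z) := by
    refine tendsto_def.2 fun U hU => ?_
    filter_upwards [hg U hU {x}ᶜ (isOpen_compl_singleton.mem_nhds hxc.symm)] with n hn
    by_contra hnU
    exact hn hnU (by simp)
  set y : ℕ → Z := fun n => h • (g ^ n)⁻¹ • x with hy
  have hyz : Tendsto y atTop (𝓝 z) := by simpa only [hz] using hback.const_smul h
  have hyne : ∀ n, y n ≠ z := fun n => hne _ _ (hne _ _ hxz)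
  have hmin : ∀ n, ∃ m : ℕ, g ^ m • y n ∉ C ∧ ∀ j < m, g ^ j • y n ∈ C := fun n => by
    classical
    exact ⟨Nat.find (hexit _ (hyne n)), Nat.find_spec (hexit _ (hyne n)),
      fun j hj => not_not.1 (Nat.find_min (hexit _ (hyne n)) hj)⟩
  choose m hmC hmlt using hmin
  have hm : Tendsto m atTop atTop := by
    refine tendsto_atTop.2 fun M => ?_
    have hall : ∀ᶠ n in atTop, ∀ j ∈ Finset.range M, g ^ j • y n ∈ C := by
      refine (Finset.eventually_all _).2 fun j _ => ?_
      have := hyz.const_smul (g ^ j)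
      rw [hz] at this
      exact this hC
    filter_upwards [hall] with n hn
    by_contra! hlt
    exact hmC n (hn _ (Finset.mem_range.2 hlt))
  set F : Ultrafilter ℕ := Ultrafilter.of atTop
  have hF : (F : Filter ℕ) ≤ atTop := Ultrafilter.of_le _
  obtain ⟨q, hq⟩ := Ultrafilter.exists_tendsto F fun n => g ^ m n • y n
  have hqz : q ≠ z := by
    rintro rfl
    obtain ⟨n, hn⟩ := (hq.eventually hC).exists
    exact hmC n hn
  have hqc : q ≠ c := by
    rintro rfl
    have h1 : ∀ᶠ n in (F : Filter ℕ), g⁻¹ • g ^ m n • y n ∈ C := by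
      filter_upwards [hF (hm.eventually (eventually_ge_atTop 1))] with n hn
      obtain ⟨j, hj⟩ := Nat.exists_eq_add_of_le' hn
      have := hmlt n j (by omega)
      rwa [hj, pow_succ', mul_smul, inv_smul_smul]
    have h2 := hCc.mem_of_tendsto (hq.const_smul g⁻¹) h1
    rw [inv_smul_eq_iff.2 hgc.symm] at h2
    exact hcC h2
  have hpc : ∀ n : ℕ, g ^ n • c = c := fun n => by
    induction n with
    | zero => simp
    | succ n ih => rw [pow_succ, mul_smul, hgc, ih]
  have hkc : ∀ n, (g ^ m n * h * (g ^ n)⁻¹) • c = g ^ m n • h • c := fun n => by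
    rw [mul_smul, mul_smul, inv_smul_eq_iff.2 (hpc n).symm]
  have hlim : Tendsto (fun n => g ^ m n • h • c) F (𝓝 c) :=
    ((hg.tendsto (hne h c hcz)).comp hm).mono_left hF
  obtain ⟨k₀, hk₀⟩ := hΓ.eventually_eq F (k := fun n => g ^ m n * h * (g ^ n)⁻¹)
    (t := fun _ => (z, c, x)) (a := (z, c, x)) (b := (z, c, q))
    ⟨hcz.symm, hxz.symm, hxc.symm⟩ ⟨hcz.symm, hqz.symm, hqc.symm⟩ tendsto_const_nhds
    (by
      simp only [Prod.smul_mk, hz, hkc]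
      refine tendsto_const_nhds.prodMk_nhds (hlim.prodMk_nhds ?_)
      simpa only [mul_smul] using hq)
  have hk₀c : k₀ • c = c := by
    refine tendsto_nhds_unique (tendsto_const_nhds.congr' ?_) hlim
    filter_upwards [hk₀] with n hn
    rw [← hkc, hn]
  obtain ⟨n, hn⟩ := hk₀.exists
  have hfix : g ^ m n • h • c = g ^ m n • c := by rw [← hkc, hn, hk₀c, hpc]
  exact smul_left_cancel _ hfix

theorem IsConvergenceAction.exists_smul_ne (hΓ : IsConvergenceAction Γ Z) {z a b : Z}
    (haz : a ≠ z) (hbz : b ≠ z) (hab : a ≠ b) (ha : ∃ w, IsLimitPair Γ w a)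
    (hb : ∃ w, IsLimitPair Γ w b) : ∃ g : Γ, g • z ≠ z := by
  by_contra! hz
  have hrep : ∀ y, y ≠ z → (∃ w, IsLimitPair Γ w y) → IsLimitPair Γ z y := by
    rintro y hy ⟨w, hw⟩
    obtain rfl : z = w := by
      by_contra hzw
      obtain ⟨g, hg⟩ := (hw {z}ᶜ (isOpen_compl_singleton.mem_nhds (Ne.symm hzw)) {z}ᶜ
        (isOpen_compl_singleton.mem_nhds hy)).nonempty
      exact hg (x := z) (by simp) (hz g)
    exact hw
  have hZ : ∀ p q : Z, ∃ r, r ≠ p ∧ r ≠ q := fun p q => by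
    by_contra! h
    by_cases h₁ : z = p
    · exact hab ((h a (h₁ ▸ haz)).trans (h b (h₁ ▸ hbz)).symm)
    · by_cases h₂ : a = p
      · exact hbz ((h b (h₂ ▸ hab.symm)).trans (h z h₁).symm)
      · exact haz ((h a h₂).trans (h z h₁).symm)
  obtain ⟨g, c, hcz, hgc, hg⟩ := hΓ.exists_loxodromic hZ hz haz hbz hab (hrep a haz ha)
  obtain ⟨x, hxz, hxc, hx⟩ : ∃ x, x ≠ z ∧ x ≠ c ∧ IsLimitPair Γ z x := by
    by_cases h : a = c
    · exact ⟨b, hbz, fun h' => hab (h.trans h'.symm), hrep b hbz hb⟩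
    · exact ⟨a, haz, h, hrep a haz ha⟩
  obtain ⟨h, hh⟩ := (hx {c}ᶜ (isOpen_compl_singleton.mem_nhds hcz.symm) {c}ᶜ
    (isOpen_compl_singleton.mem_nhds hxc)).nonempty
  exact hh (x := c) (by simp) (hΓ.smul_eq_of_loxodromic hz hcz hxz hxc hgc hg h)

end ConvergenceAction

/-- For a convergence action of a group `Γ` on a compact metrizable space `Z` (realized as
a compact metric space) whose limit set `Λ` has at least 3 points, `Λ` is perfect (every
point of `Λ` is an accumulation point of `Λ`) and the action of `Γ` on `Λ` is minimal
(every orbit of a point of `Λ` is dense in `Λ`). -/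
theorem limitSet_perfect_and_minimal
    {Γ Z : Type*} [Group Γ] [MetricSpace Z] [CompactSpace Z]
    (ρ : Γ → Z ≃ₜ Z)
    (hρ : ∀ g h : Γ, ρ (g * h) = (ρ h).trans (ρ g))
    (hρ1 : ρ 1 = Homeomorph.refl Z)
    -- the action is properly discontinuous on the space of distinct triples
    (hconv : ∀ K : Set (Z × Z × Z), IsCompact K →
      (∀ t ∈ K, t.1 ≠ t.2.1 ∧ t.1 ≠ t.2.2 ∧ t.2.1 ≠ t.2.2) →
      {g : Γ | ∃ t ∈ K, (ρ g t.1, ρ g t.2.1, ρ g t.2.2) ∈ K}.Finite)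
    -- the limit set
    (Λ : Set Z)
    (hΛ : Λ = {z : Z | ∃ g : ℕ → Γ, Function.Injective g ∧ ∃ w : Z,
      ∀ K : Set Z, IsCompact K → K ⊆ {w}ᶜ →
        TendstoUniformlyOn (fun n x => ρ (g n) x) (fun _ => z) Filter.atTop K})
    (hcard : ∃ a ∈ Λ, ∃ b ∈ Λ, ∃ c ∈ Λ, a ≠ b ∧ a ≠ c ∧ b ≠ c) :
    (∀ z ∈ Λ, AccPt z (Filter.principal Λ)) ∧
    (∀ z ∈ Λ, Λ ⊆ closure {w : Z | ∃ g : Γ, ρ g z = w}) := by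
  let _ : MulAction Γ Z :=
    { smul := fun g x => ρ g x
      one_smul := fun x => by
        change ρ 1 x = x
        rw [hρ1]; rfl
      mul_smul := fun g h x => by
        change ρ (g * h) x = ρ g (ρ h x)
        rw [hρ]; rfl }
  have : ContinuousConstSMul Γ Z := ⟨fun g => (ρ g).continuous⟩
  have hΓ : IsConvergenceAction Γ Z := hconv
  have hpair : ∀ z ∈ Λ, ∃ w, IsLimitPair Γ w z := by
    intro z hz
    rw [hΛ] at hz
    obtain ⟨g, hg, w, h⟩ := hz
    refine ⟨w, fun U hU V hV => ?_⟩
    have hK := h (interior U)ᶜ isOpen_interior.isClosed_compl.isCompact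
      (compl_subset_compl.2 (singleton_subset_iff.2 (mem_interior_iff_mem_nhds.2 hU)))
    obtain ⟨ε, hε, hεV⟩ := Metric.mem_nhds_iff.1 hV
    obtain ⟨N, hN⟩ := eventually_atTop.1 (Metric.tendstoUniformlyOn_iff.1 hK ε hε)
    refine ((Set.Ici_infinite N).image hg.injOn).mono ?_
    rintro _ ⟨n, hn, rfl⟩ x hx
    refine hεV ?_
    rw [Metric.mem_ball, dist_comm]
    exact hN n hn x fun hx' => hx (interior_subset hx')
  have hinv : ∀ h : Γ, ∀ z ∈ Λ, h • z ∈ Λ := by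
    intro h z hz
    rw [hΛ] at hz ⊢
    obtain ⟨g, hg, w, hw⟩ := hz
    refine ⟨fun n => h * g n, fun m n hmn => hg (mul_left_cancel hmn), w, fun K hK hKw => ?_⟩
    have := (CompactSpace.uniformContinuous_of_continuous
      (ρ h).continuous).comp_tendstoUniformlyOn (hw K hK hKw)
    refine this.congr (Eventually.of_forall fun n x _ => ?_)
    change ρ h (ρ (g n) x) = ρ (h * g n) x
    rw [hρ]; rfl
  obtain ⟨a, ha, b, hb, c, hc, hab, hac, hbc⟩ := hcard
  have htwo : ∀ z : Z, ∃ x ∈ Λ, ∃ y ∈ Λ, x ≠ z ∧ y ≠ z ∧ x ≠ y := by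
    intro z
    by_cases h₁ : a = z
    · exact ⟨b, hb, c, hc, h₁ ▸ hab.symm, h₁ ▸ hac.symm, hbc⟩
    by_cases h₂ : b = z
    · exact ⟨a, ha, c, hc, h₁, h₂ ▸ hbc.symm, hac⟩
    · exact ⟨a, ha, b, hb, h₁, h₂, hab⟩
  refine ⟨fun z hz => ?_, fun z hz y hy => ?_⟩
  · obtain ⟨w, hw⟩ := hpair z hz
    obtain ⟨x, hx, y, hy, hxw, hyw, hxy⟩ := htwo w
    refine accPt_iff_nhds.2 fun V hV => ?_
    obtain ⟨g, hg⟩ := (hw {x, y}ᶜ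
      (((Set.finite_singleton y).insert x).isClosed.isOpen_compl.mem_nhds
        (by simp [hxw.symm, hyw.symm])) V hV).nonempty
    rw [compl_compl] at hg
    by_cases h : g • x = z
    · refine ⟨g • y, ⟨hg (by simp), hinv g y hy⟩, fun h' => hxy ?_⟩
      exact smul_left_cancel g (h.trans h'.symm)
    · exact ⟨g • x, ⟨hg (by simp), hinv g x hx⟩, h⟩
  · obtain ⟨w, hw⟩ := hpair y hy
    obtain ⟨x, hx, x', hx', hxz, hxz', hxx⟩ := htwo z
    obtain ⟨h, hh⟩ : ∃ h : Γ, h • z ≠ w := by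
      by_cases hzw : z = w
      · obtain ⟨h, hh⟩ := hΓ.exists_smul_ne hxz hxz' hxx (hpair x hx) (hpair x' hx')
        exact ⟨h, hzw ▸ hh⟩
      · exact ⟨1, by rwa [one_smul]⟩
    refine mem_closure_iff_nhds.2 fun V hV => ?_
    obtain ⟨g, hg⟩ := (hw {h • z}ᶜ (isOpen_compl_singleton.mem_nhds hh.symm) V hV).nonempty
    refine ⟨g • h • z, hg (by simp), g * h, ?_⟩
    exact mul_smul g h z
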